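/- Distributional Fourier transform of log|x|: For every Schwartz function φ : ℝ → ℂ with Fourier transform φ̂(k) = ∫_ℝ φ(x)e^{−ikx}dx, one has ∫_ℝ log|x|·φ̂(x) dx = −π·( ∫_{|x|≤1} (φ(x) − φ(0))/|x| dx + ∫_{|x|>1} φ(x)/|x| dx ) − 2πγ·φ(0), where γ is the Euler–Mascheroni constant. -/

import Mathlib

open MeasureTheory Real

/-- The Fourier transform `φ̂(k) = ∫ φ(x) e^{−ikx} dx` of a Schwartz function. -/
noncomputable def fourierT (φ : SchwartzMap ℝ ℂ) (k : ℝ) : ℂ :=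
  ∫ x : ℝ, φ x * Complex.exp (-Complex.I * (k : ℂ) * (x : ℂ))

open Set Filter Topology
open scoped SchwartzMap FourierTransform

theorem integral_log_mul_exp_neg_Ioi :
    ∫ t in Ioi (0 : ℝ), Real.log t * Real.exp (-t) = -Real.eulerMascheroniConstant := by
  have h := Complex.hasDerivAt_GammaIntegral (s := 1) (by simp)
  have h' : HasDerivAt Complex.GammaIntegral (-(Real.eulerMascheroniConstant : ℂ)) 1 := by
    refine Complex.hasDerivAt_Gamma_one.congr_of_eventuallyEq ?_
    filter_upwards [(isOpen_lt continuous_const Complex.continuous_re).mem_nhds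
      (show (0 : ℝ) < (1 : ℂ).re by simp)] with s hs
    exact (Complex.Gamma_eq_integral hs).symm
  have h2 := h.unique h'
  simp only [sub_self, Complex.cpow_zero, one_mul] at h2
  have h3 : ((∫ t in Ioi (0 : ℝ), Real.log t * Real.exp (-t) : ℝ) : ℂ)
      = ((-Real.eulerMascheroniConstant : ℝ) : ℂ) := by
    rw [← integral_complex_ofReal]
    simpa using h2
  exact_mod_cast h3

theorem integrableOn_log_mul_exp_neg_Ioi :
    IntegrableOn (fun t : ℝ ↦ Real.log t * Real.exp (-t)) (Ioi 0) := by
  by_contra h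
  have h1 := integral_undef h
  rw [integral_log_mul_exp_neg_Ioi] at h1
  linarith [Real.one_half_lt_eulerMascheroniConstant]

theorem integrableOn_div_one_add_sq_sub_one_sub_exp_neg_div :
    IntegrableOn (fun t : ℝ ↦ t / (1 + t ^ 2) - (1 - Real.exp (-t)) / t) (Ioi 0) := by
  refine Integrable.mono' (g := fun t ↦ 2 * (1 + t ^ 2)⁻¹)
    (integrable_inv_one_add_sq.integrableOn.const_mul 2) ?_ ?_
  · exact Measurable.aestronglyMeasurable (by fun_prop)
  · filter_upwards [ae_restrict_mem measurableSet_Ioi] with t ht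
    have ht : 0 < t := ht
    have e : t / (1 + t ^ 2) - (1 - Real.exp (-t)) / t
        = ((1 + t ^ 2) * Real.exp (-t) - 1) / (t * (1 + t ^ 2)) := by
      field_simp
      ring
    have l : 1 - t ≤ Real.exp (-t) := by linarith [Real.add_one_le_exp (-t)]
    have q := Real.quadratic_le_exp_of_nonneg ht.le
    have u : (1 + t ^ 2) * Real.exp (-t) ≤ 1 + 2 * t := by
      rw [Real.exp_neg, ← div_eq_mul_inv, div_le_iff₀ (Real.exp_pos t)]
      nlinarith [mul_pos ht ht, mul_pos (mul_pos ht ht) ht]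
    have l2 : 1 - 2 * t ≤ (1 + t ^ 2) * Real.exp (-t) := by
      have := Real.exp_pos (-t)
      nlinarith [mul_pos (mul_pos ht ht) this]
    rw [e, Real.norm_eq_abs, abs_div, abs_of_pos (show 0 < t * (1 + t ^ 2) by positivity),
      div_le_iff₀ (by positivity), abs_le]
    have : 2 * (1 + t ^ 2)⁻¹ * (t * (1 + t ^ 2)) = 2 * t := by field_simp
    constructor <;> linarith

theorem integral_div_one_add_sq_sub_one_sub_exp_neg_div :
    ∫ t in Ioi (0 : ℝ), (t / (1 + t ^ 2) - (1 - Real.exp (-t)) / t)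
      = -Real.eulerMascheroniConstant := by
  have key : ∫ t in Ioi (0 : ℝ), ((t / (1 + t ^ 2) - (1 - Real.exp (-t)) / t)
      - Real.log t * Real.exp (-t)) = 0 -
        (Real.log (1 + 0 ^ 2) / 2 - Real.log 0 * (1 - Real.exp (-0))) := by
    refine integral_Ioi_of_hasDerivAt_of_tendsto
      (f := fun t ↦ Real.log (1 + t ^ 2) / 2 - Real.log t * (1 - Real.exp (-t))) ?_ ?_
      (integrableOn_div_one_add_sq_sub_one_sub_exp_neg_div.sub
        integrableOn_log_mul_exp_neg_Ioi) ?_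
    · refine ContinuousWithinAt.sub (ContinuousAt.continuousWithinAt ?_) ?_
      · exact ContinuousAt.div_const (ContinuousAt.log (by fun_prop) (by norm_num)) _
      · have h0 : Tendsto (fun t : ℝ ↦ |t * Real.log t|) (𝓝[≥] 0) (𝓝 0) := by
          have := (Real.continuous_mul_log.abs.tendsto 0).mono_left
            (nhdsWithin_le_nhds (s := Ici 0))
          simpa using this
        rw [ContinuousWithinAt]
        simp only [Real.log_zero, zero_mul]
        refine squeeze_zero_norm' ?_ h0
        filter_upwards [self_mem_nhdsWithin] with t ht
        have ht : 0 ≤ t := ht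
        rw [Real.norm_eq_abs, abs_mul, abs_mul, mul_comm]
        gcongr ?_ * _
        have h1 := Real.add_one_le_exp (-t)
        have h2 : Real.exp (-t) ≤ 1 := Real.exp_le_one_iff.2 (by linarith)
        rw [abs_of_nonneg ht, abs_of_nonneg (by linarith)]
        linarith
    · intro t ht
      have ht : 0 < t := ht
      have h1 : HasDerivAt (fun t : ℝ ↦ 1 + t ^ 2) (2 * t) t := by
        simpa using (hasDerivAt_pow 2 t).const_add 1
      have h2 : HasDerivAt (fun t : ℝ ↦ 1 - Real.exp (-t)) (Real.exp (-t)) t := by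
        simpa using ((hasDerivAt_neg t).exp.const_sub 1)
      refine ((h1.log (by positivity)).div_const 2 |>.sub
        ((Real.hasDerivAt_log ht.ne').mul h2)).congr_deriv ?_
      field_simp
      ring
    · have h1 : Tendsto (fun t : ℝ ↦ Real.log (1 + (t ^ 2)⁻¹) / 2) atTop (𝓝 0) := by
        have : Tendsto (fun t : ℝ ↦ 1 + (t ^ 2)⁻¹) atTop (𝓝 (1 + 0)) :=
          (tendsto_inv_atTop_zero.comp (tendsto_pow_atTop two_ne_zero)).const_add 1
        have := (this.log (by norm_num)).div_const 2
        simpa using this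
      have h2 : Tendsto (fun t : ℝ ↦ Real.log t * Real.exp (-t)) atTop (𝓝 0) := by
        refine squeeze_zero' ?_ ?_ (by simpa using Real.tendsto_pow_mul_exp_neg_atTop_nhds_zero 1)
        · filter_upwards [eventually_ge_atTop 1] with t ht
          exact mul_nonneg (Real.log_nonneg ht) (Real.exp_pos _).le
        · filter_upwards [eventually_ge_atTop 0] with t ht
          exact mul_le_mul_of_nonneg_right (Real.log_le_self ht) (Real.exp_pos _).le
      have := h1.add h2
      rw [add_zero] at this
      refine this.congr' ?_
      filter_upwards [eventually_gt_atTop 0] with t ht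
      have : 1 + (t ^ 2)⁻¹ = (1 + t ^ 2) / t ^ 2 := by field_simp; ring
      rw [this, Real.log_div (by positivity) (by positivity), Real.log_pow]
      push_cast
      ring
  rw [integral_sub integrableOn_div_one_add_sq_sub_one_sub_exp_neg_div
        integrableOn_log_mul_exp_neg_Ioi, integral_log_mul_exp_neg_Ioi] at key
  simp at key
  linarith

/-- The kernel representing `log |x|` as a superposition of Cauchy kernels. -/
noncomputable def logKernel (x t : ℝ) : ℝ := t / (1 + t ^ 2) - t / (x ^ 2 + t ^ 2)

theorem hasDerivAt_logKernel_primitive {x : ℝ} (hx : x ≠ 0) (t : ℝ) :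
    HasDerivAt (fun t ↦ (Real.log (1 + t ^ 2) - Real.log (x ^ 2 + t ^ 2)) / 2)
      (logKernel x t) t := by
  have h (c : ℝ) : HasDerivAt (fun t : ℝ ↦ c + t ^ 2) (2 * t) t := by
    simpa using (hasDerivAt_pow 2 t).const_add c
  have : 0 < x ^ 2 := by positivity
  refine (((h 1).log (by positivity)).sub ((h (x ^ 2)).log (by positivity)) |>.div_const 2
    ).congr_deriv ?_
  rw [logKernel]
  field_simp

theorem tendsto_logKernel_primitive {x : ℝ} (hx : x ≠ 0) :
    Tendsto (fun t ↦ (Real.log (1 + t ^ 2) - Real.log (x ^ 2 + t ^ 2)) / 2) atTop (𝓝 0) := by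
  have hx2 : 0 < x ^ 2 := by positivity
  have h (c : ℝ) : Tendsto (fun t : ℝ ↦ Real.log (c * (t ^ 2)⁻¹ + 1)) atTop (𝓝 0) := by
    have : Tendsto (fun t : ℝ ↦ c * (t ^ 2)⁻¹ + 1) atTop (𝓝 (c * 0 + 1)) :=
      ((tendsto_inv_atTop_zero.comp (tendsto_pow_atTop two_ne_zero)).const_mul c).add_const 1
    simpa using this.log (by norm_num)
  have := ((h 1).sub (h (x ^ 2))).div_const 2
  simp only [sub_zero, zero_div] at this
  refine this.congr' ?_
  filter_upwards [eventually_gt_atTop 0] with t ht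
  have e (c : ℝ) : c * (t ^ 2)⁻¹ + 1 = (c + t ^ 2) / t ^ 2 := by field_simp
  rw [e, e, Real.log_div (by positivity) (by positivity),
    Real.log_div (by positivity) (by positivity)]
  ring

theorem logKernel_eq {x : ℝ} (hx : x ≠ 0) (t : ℝ) :
    logKernel x t = t * (x ^ 2 - 1) / ((1 + t ^ 2) * (x ^ 2 + t ^ 2)) := by
  have : 0 < x ^ 2 := by positivity
  rw [logKernel]
  field_simp
  ring

theorem integrableOn_logKernel {x : ℝ} (hx : x ≠ 0) : IntegrableOn (logKernel x) (Ioi 0) := by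
  rcases le_total 1 (x ^ 2) with h | h
  · refine integrableOn_Ioi_deriv_of_nonneg' (fun t _ ↦ hasDerivAt_logKernel_primitive hx t)
      (fun t ht ↦ ?_) (tendsto_logKernel_primitive hx)
    rw [logKernel_eq hx]
    exact div_nonneg (mul_nonneg (le_of_lt ht) (by linarith)) (by positivity)
  · refine integrableOn_Ioi_deriv_of_nonpos' (fun t _ ↦ hasDerivAt_logKernel_primitive hx t)
      (fun t ht ↦ ?_) (tendsto_logKernel_primitive hx)
    rw [logKernel_eq hx]
    exact div_nonpos_of_nonpos_of_nonneg
      (mul_nonpos_of_nonneg_of_nonpos (le_of_lt ht) (by linarith)) (by positivity)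

theorem integral_logKernel {x : ℝ} (hx : x ≠ 0) :
    ∫ t in Ioi (0 : ℝ), logKernel x t = Real.log |x| := by
  rw [integral_Ioi_of_hasDerivAt_of_tendsto' (fun t _ ↦ hasDerivAt_logKernel_primitive hx t)
    (integrableOn_logKernel hx) (tendsto_logKernel_primitive hx)]
  simp [neg_div]

theorem integral_norm_logKernel {x : ℝ} (hx : x ≠ 0) :
    ∫ t in Ioi (0 : ℝ), ‖logKernel x t‖ = ‖Real.log |x|‖ := by
  rw [← integral_logKernel hx]
  rcases le_total 1 (x ^ 2) with h | h
  · have hk : ∀ t ∈ Ioi (0 : ℝ), 0 ≤ logKernel x t := fun t ht ↦ by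
      rw [logKernel_eq hx]
      exact div_nonneg (mul_nonneg (le_of_lt ht) (by linarith)) (by positivity)
    rw [Real.norm_of_nonneg (setIntegral_nonneg measurableSet_Ioi hk)]
    exact setIntegral_congr_fun measurableSet_Ioi fun t ht ↦ Real.norm_of_nonneg (hk t ht)
  · have hk : ∀ t ∈ Ioi (0 : ℝ), logKernel x t ≤ 0 := fun t ht ↦ by
      rw [logKernel_eq hx]
      exact div_nonpos_of_nonpos_of_nonneg
        (mul_nonpos_of_nonneg_of_nonpos (le_of_lt ht) (by linarith)) (by positivity)
    rw [Real.norm_of_nonpos (setIntegral_nonpos measurableSet_Ioi hk), ← integral_neg]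
    exact setIntegral_congr_fun measurableSet_Ioi fun t ht ↦ Real.norm_of_nonpos (hk t ht)

theorem fourierT_eq_fourier (φ : 𝓢(ℝ, ℂ)) (k : ℝ) : fourierT φ k = 𝓕 φ (k / (2 * π)) := by
  rw [SchwartzMap.fourier_coe, fourier_real_eq_integral_exp_smul, fourierT]
  refine integral_congr_ae (Eventually.of_forall fun x ↦ ?_)
  simp only [smul_eq_mul]
  rw [mul_comm]
  congr 2
  have : (π : ℂ) ≠ 0 := by exact_mod_cast pi_ne_zero
  push_cast
  field_simp

theorem exists_schwartz_eq_fourierT (φ : 𝓢(ℝ, ℂ)) : ∃ ψ : 𝓢(ℝ, ℂ), fourierT φ = ψ := by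
  refine ⟨SchwartzMap.compCLMOfContinuousLinearEquiv ℂ
    (ContinuousLinearEquiv.smulLeft (Units.mk0 ((2 * π)⁻¹ : ℝ) (by positivity))) (𝓕 φ), ?_⟩
  ext k
  rw [fourierT_eq_fourier]
  rw [div_eq_inv_mul]
  rfl

theorem integral_fourierT_mul_exp (φ : 𝓢(ℝ, ℂ)) (y : ℝ) :
    ∫ x : ℝ, fourierT φ x * Complex.exp (Complex.I * x * y) = 2 * π * φ y := by
  have h1 : φ y = 𝓕⁻ (𝓕 φ) y := by rw [FourierTransform.fourierInv_fourier_eq]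
  rw [SchwartzMap.fourierInv_coe, fourierInv_eq'] at h1
  have h2 := Measure.integral_comp_div
    (fun x : ℝ ↦ Complex.exp (↑(2 * π * inner ℝ x y) * Complex.I) • 𝓕 φ x) (2 * π)
  rw [← h1, abs_of_pos (by positivity)] at h2
  have h3 : ((2 * π : ℝ) • φ y : ℂ) = 2 * π * φ y := by simp
  rw [← h3, ← h2]
  refine integral_congr_ae (Eventually.of_forall fun x ↦ ?_)
  simp only [smul_eq_mul, fourierT_eq_fourier]
  rw [mul_comm]
  congr 2
  have : (π : ℂ) ≠ 0 := by exact_mod_cast pi_ne_zero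
  simp
  field_simp

theorem SchwartzMap.integrable_log_abs_mul (ψ : 𝓢(ℝ, ℂ)) :
    Integrable fun x : ℝ ↦ ((Real.log |x| : ℝ) : ℂ) * ψ x := by
  obtain ⟨C, hC⟩ : ∃ C, ∀ x, ‖ψ x‖ ≤ C := ⟨_, SchwartzMap.norm_le_seminorm ℝ ψ⟩
  have hlog : IntegrableOn Real.log (Ioc (-1) 1) :=
    (intervalIntegrable_iff_integrableOn_Ioc_of_le (by norm_num)).1
      intervalIntegral.intervalIntegrable_log'
  have h1 := ((integrable_indicator_iff measurableSet_Ioc).2 hlog.norm).mul_const C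
  refine (h1.add (ψ.integrable_pow_mul volume 1)).mono' ?_ (Eventually.of_forall fun x ↦ ?_)
  · exact (Measurable.aestronglyMeasurable (by fun_prop)).mul ψ.continuous.aestronglyMeasurable
  · have hC0 : 0 ≤ C := (norm_nonneg _).trans (hC 0)
    simp only [Pi.add_apply, pow_one, norm_mul, Complex.norm_real, Real.log_abs]
    by_cases hx : x ∈ Ioc (-1 : ℝ) 1
    · rw [indicator_of_mem hx]
      have := mul_le_mul_of_nonneg_left (hC x) (norm_nonneg (Real.log x))
      have : 0 ≤ ‖x‖ * ‖ψ x‖ := by positivity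
      linarith
    · rw [indicator_of_notMem hx, zero_mul, zero_add]
      have h1 : 1 ≤ |x| := by
        by_contra! h
        exact hx ⟨(abs_lt.1 h).1, (abs_lt.1 h).2.le⟩
      gcongr
      rw [← Real.log_abs, Real.norm_of_nonneg (Real.log_nonneg h1)]
      exact Real.log_le_self (abs_nonneg x)

theorem integrable_exp_neg_mul_abs {t : ℝ} (ht : 0 < t) :
    Integrable fun y : ℝ ↦ Real.exp (-t * |y|) := by
  refine Integrable.of_integral_ne_zero ?_
  rw [integral_comp_abs (f := fun y ↦ Real.exp (-t * y)), integral_exp_mul_Ioi (by linarith)]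
  simp [ht.ne']

theorem integral_exp_neg_mul_abs_mul_exp {t : ℝ} (ht : 0 < t) (x : ℝ) :
    ∫ y : ℝ, (Real.exp (-t * |y|) : ℂ) * Complex.exp (Complex.I * x * y)
      = ((2 * (t / (x ^ 2 + t ^ 2)) : ℝ) : ℂ) := by
  have e1 : ∀ y ∈ Iic (0 : ℝ), (Real.exp (-t * |y|) : ℂ) * Complex.exp (Complex.I * x * y)
      = Complex.exp ((t + Complex.I * x) * y) := fun y hy ↦ by
    rw [abs_of_nonpos hy, Complex.ofReal_exp, ← Complex.exp_add]
    congr 1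
    push_cast
    ring
  have e2 : ∀ y ∈ Ioi (0 : ℝ), (Real.exp (-t * |y|) : ℂ) * Complex.exp (Complex.I * x * y)
      = Complex.exp ((-t + Complex.I * x) * y) := fun y hy ↦ by
    rw [abs_of_pos hy, Complex.ofReal_exp, ← Complex.exp_add]
    congr 1
    push_cast
    ring
  have r1 : 0 < ((t : ℂ) + Complex.I * x).re := by simpa
  have r2 : (-(t : ℂ) + Complex.I * x).re < 0 := by simpa
  have n1 : (t : ℂ) + Complex.I * x ≠ 0 := fun h ↦ by simp [h] at r1
  have n2 : -(t : ℂ) + Complex.I * x ≠ 0 := fun h ↦ by simp [h] at r2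
  have n3 : (x : ℂ) ^ 2 + t ^ 2 ≠ 0 := by
    have : 0 < x ^ 2 + t ^ 2 := by positivity
    exact_mod_cast this.ne'
  rw [← intervalIntegral.integral_Iic_add_Ioi (b := 0)
      ((integrableOn_exp_mul_complex_Iic r1 0).congr_fun (fun y hy ↦ (e1 y hy).symm)
        measurableSet_Iic)
      ((integrableOn_exp_mul_complex_Ioi r2 0).congr_fun (fun y hy ↦ (e2 y hy).symm)
        measurableSet_Ioi),
    setIntegral_congr_fun measurableSet_Iic e1, setIntegral_congr_fun measurableSet_Ioi e2,
    integral_exp_mul_complex_Iic r1, integral_exp_mul_complex_Ioi r2]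
  simp only [Complex.ofReal_zero, mul_zero, Complex.exp_zero]
  push_cast
  field_simp
  linear_combination (-2 * (t : ℂ) * x ^ 2) * Complex.I_sq

/-- Integrating the Fourier transform of `φ` against a Cauchy kernel. -/
theorem integral_fourierT_mul_cauchy (φ : 𝓢(ℝ, ℂ)) {t : ℝ} (ht : 0 < t) :
    ∫ x : ℝ, fourierT φ x * ((t / (x ^ 2 + t ^ 2) : ℝ) : ℂ)
      = π * ∫ y : ℝ, φ y * (Real.exp (-t * |y|) : ℂ) := by
  obtain ⟨ψ, hψ⟩ := exists_schwartz_eq_fourierT φ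
  have hint : Integrable (Function.uncurry fun x y : ℝ ↦
      fourierT φ x * ((Real.exp (-t * |y|) : ℂ) * Complex.exp (Complex.I * x * y)))
      (volume.prod volume) := by
    rw [hψ]
    refine (ψ.integrable (μ := volume) |>.mul_prod
      (integrable_exp_neg_mul_abs ht).ofReal).mono ?_ (Eventually.of_forall fun p ↦ ?_)
    · exact Continuous.aestronglyMeasurable (by fun_prop)
    · have : ‖Complex.exp (Complex.I * p.1 * p.2)‖ = 1 := by
        rw [mul_assoc, ← Complex.ofReal_mul, mul_comm, Complex.norm_exp_ofReal_mul_I]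
      simp [Function.uncurry, this]
  have h := integral_integral_swap hint
  simp_rw [integral_const_mul, integral_exp_neg_mul_abs_mul_exp ht] at h
  have e (x y : ℝ) : fourierT φ x * ((Real.exp (-t * |y|) : ℂ) * Complex.exp (Complex.I * x * y))
      = Real.exp (-t * |y|) * (fourierT φ x * Complex.exp (Complex.I * x * y)) := by ring
  simp_rw [e, integral_const_mul, integral_fourierT_mul_exp] at h
  have e2 (y : ℝ) : (Real.exp (-t * |y|) : ℂ) * (2 * π * φ y)
      = 2 * π * (φ y * Real.exp (-t * |y|)) := by ring
  have e3 (x : ℝ) : fourierT φ x * ((2 * (t / (x ^ 2 + t ^ 2)) : ℝ) : ℂ)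
      = 2 * (fourierT φ x * ((t / (x ^ 2 + t ^ 2) : ℝ) : ℂ)) := by
    push_cast
    ring
  simp_rw [e2, e3, integral_const_mul] at h
  linear_combination h / 2

/-- The density of the finite part `Pf (1 / |x|)` applied to `φ`, before division by `|x|`. -/
noncomputable def finitePartNumerator (φ : 𝓢(ℝ, ℂ)) (y : ℝ) : ℂ :=
  φ y - {y : ℝ | |y| ≤ 1}.indicator (fun _ ↦ φ 0) y

theorem measurableSet_abs_le_one : MeasurableSet {y : ℝ | |y| ≤ 1} :=
  measurableSet_le (by fun_prop) measurable_const

theorem measurable_finitePartNumerator (φ : 𝓢(ℝ, ℂ)) : Measurable (finitePartNumerator φ) :=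
  φ.continuous.measurable.sub (measurable_const.indicator measurableSet_abs_le_one)

theorem integrable_indicator_abs_le_one (c : ℂ) :
    Integrable ({y : ℝ | |y| ≤ 1}.indicator fun _ ↦ c) := by
  rw [integrable_indicator_iff measurableSet_abs_le_one]
  have : {y : ℝ | |y| ≤ 1} = Icc (-1) 1 := by
    ext y
    simp [abs_le]
  rw [this]
  exact integrableOn_const (by simp)

theorem integrable_finitePartNumerator_div (φ : 𝓢(ℝ, ℂ)) :
    Integrable fun y : ℝ ↦ finitePartNumerator φ y / ((|y| : ℝ) : ℂ) := by
  obtain ⟨C, hC⟩ : ∃ C, ∀ x, ‖SchwartzMap.derivCLM ℝ ℂ φ x‖ ≤ C :=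
    ⟨_, SchwartzMap.norm_le_seminorm ℝ _⟩
  have hlip (y : ℝ) : ‖φ y - φ 0‖ ≤ C * |y| := by
    simpa using convex_univ.norm_image_sub_le_of_norm_deriv_le (f := φ)
      (fun x _ ↦ φ.differentiable x) (fun x _ ↦ hC x) (mem_univ 0) (mem_univ y)
  have hC0 : 0 ≤ C := (norm_nonneg _).trans (hC 0)
  refine ((integrable_indicator_abs_le_one (C : ℂ)).norm.add φ.integrable.norm).mono' ?_
    (Eventually.of_forall fun y ↦ ?_)
  · exact ((measurable_finitePartNumerator φ).div (by fun_prop)).aestronglyMeasurable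
  · simp only [Pi.add_apply, norm_div, Complex.norm_real, norm_abs_eq_norm, Real.norm_eq_abs,
      finitePartNumerator]
    by_cases hy : |y| ≤ 1
    · have hy' : y ∈ {y : ℝ | |y| ≤ 1} := hy
      rw [indicator_of_mem hy', indicator_of_mem hy', Complex.norm_real, Real.norm_of_nonneg hC0]
      have := div_le_of_le_mul₀ (abs_nonneg y) hC0 (hlip y)
      linarith [norm_nonneg (φ y)]
    · have hy' : y ∉ {y : ℝ | |y| ≤ 1} := hy
      rw [indicator_of_notMem hy', indicator_of_notMem hy', sub_zero, norm_zero, zero_add]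
      exact div_le_self (norm_nonneg _) (not_le.1 hy).le

theorem integral_finitePartNumerator_div (φ : 𝓢(ℝ, ℂ)) :
    ∫ y : ℝ, finitePartNumerator φ y / ((|y| : ℝ) : ℂ)
      = (∫ x in {x : ℝ | |x| ≤ 1}, (φ x - φ 0) / ((|x| : ℝ) : ℂ)) +
          ∫ x in {x : ℝ | 1 < |x|}, φ x / ((|x| : ℝ) : ℂ) := by
  have hc : {x : ℝ | 1 < |x|} = {x : ℝ | |x| ≤ 1}ᶜ := by
    ext x
    simp
  rw [hc, ← integral_add_compl measurableSet_abs_le_one (integrable_finitePartNumerator_div φ)]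
  congr 1
  · refine setIntegral_congr_fun measurableSet_abs_le_one fun x hx ↦ ?_
    simp only [finitePartNumerator, indicator_of_mem hx]
  · refine setIntegral_congr_fun measurableSet_abs_le_one.compl fun x hx ↦ ?_
    simp only [finitePartNumerator, indicator_of_notMem hx, sub_zero]

theorem integral_exp_neg_mul_Ioi_zero {a : ℝ} (ha : 0 < a) :
    ∫ t in Ioi (0 : ℝ), Real.exp (-t * a) = 1 / a := by
  have := integral_exp_mul_Ioi (a := -a) (by linarith) 0
  simp only [mul_zero, Real.exp_zero, neg_div_neg_eq] at this
  rw [← this]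
  congr with t
  ring_nf

theorem integrable_finitePartNumerator_mul_exp (φ : 𝓢(ℝ, ℂ)) :
    Integrable (Function.uncurry fun y t : ℝ ↦
      finitePartNumerator φ y * (Real.exp (-t * |y|) : ℂ))
      (volume.prod (volume.restrict (Ioi 0))) := by
  have hm : Measurable (Function.uncurry fun y t : ℝ ↦
      finitePartNumerator φ y * (Real.exp (-t * |y|) : ℂ)) := by
    have := measurable_finitePartNumerator φ
    unfold Function.uncurry
    fun_prop
  have hne : ∀ᵐ y : ℝ, y ≠ 0 := Measure.ae_ne volume 0
  refine (integrable_prod_iff hm.aestronglyMeasurable).2 ⟨?_, ?_⟩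
  · filter_upwards [hne] with y hy
    have h : IntegrableOn (fun t : ℝ ↦ Real.exp (-t * |y|)) (Ioi 0) := by
      simpa [mul_comm] using integrableOn_exp_mul_Ioi (a := -|y|) (by simpa using hy) 0
    have h' : IntegrableOn (fun t : ℝ ↦ (Real.exp (-t * |y|) : ℂ)) (Ioi 0) :=
      h.ofReal
    exact h'.const_mul (finitePartNumerator φ y)
  · refine (integrable_finitePartNumerator_div φ).norm.congr ?_
    filter_upwards [hne] with y hy
    simp only [Function.uncurry, norm_mul, Complex.norm_real, Real.norm_eq_abs, Real.abs_exp,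
      integral_const_mul, integral_exp_neg_mul_Ioi_zero (abs_pos.2 hy), norm_div, abs_abs]
    ring

theorem integral_integral_finitePartNumerator_mul_exp (φ : 𝓢(ℝ, ℂ)) :
    ∫ t in Ioi (0 : ℝ), ∫ y : ℝ, finitePartNumerator φ y * (Real.exp (-t * |y|) : ℂ)
      = ∫ y : ℝ, finitePartNumerator φ y / ((|y| : ℝ) : ℂ) := by
  rw [← integral_integral_swap (integrable_finitePartNumerator_mul_exp φ)]
  refine integral_congr_ae ?_
  filter_upwards [Measure.ae_ne volume 0] with y hy
  rw [integral_const_mul, integral_complex_ofReal, integral_exp_neg_mul_Ioi_zero (abs_pos.2 hy)]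
  push_cast
  ring

theorem integral_exp_neg_mul_abs_le_one {t : ℝ} (ht : 0 < t) :
    ∫ y in {y : ℝ | |y| ≤ 1}, Real.exp (-t * |y|) = 2 * ((1 - Real.exp (-t)) / t) := by
  have h := integral_comp_abs (f := (Iic (1 : ℝ)).indicator fun y ↦ Real.exp (-t * y))
  rw [← integral_indicator measurableSet_abs_le_one]
  have e : ({y : ℝ | |y| ≤ 1}.indicator fun y ↦ Real.exp (-t * |y|))
      = fun y ↦ (Iic (1 : ℝ)).indicator (fun y ↦ Real.exp (-t * y)) |y| := by
    ext y
    simp [indicator]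
  rw [e, h, setIntegral_indicator measurableSet_Iic, Ioi_inter_Iic,
    ← intervalIntegral.integral_of_le zero_le_one]
  congr 1
  rw [intervalIntegral.integral_comp_mul_left Real.exp (neg_ne_zero.2 ht.ne')]
  simp
  field_simp
  ring

theorem integral_mul_exp_neg_mul_abs (φ : 𝓢(ℝ, ℂ)) {t : ℝ} (ht : 0 < t) :
    ∫ y : ℝ, φ y * (Real.exp (-t * |y|) : ℂ)
      = (∫ y : ℝ, finitePartNumerator φ y * (Real.exp (-t * |y|) : ℂ))
        + φ 0 * ((2 * ((1 - Real.exp (-t)) / t) : ℝ) : ℂ) := by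
  have hexp : Integrable fun y : ℝ ↦ (Real.exp (-t * |y|) : ℂ) :=
    (integrable_exp_neg_mul_abs ht).ofReal
  have hb (y : ℝ) : ‖(Real.exp (-t * |y|) : ℂ)‖ ≤ 1 := by
    rw [Complex.norm_real, Real.norm_eq_abs, Real.abs_exp]
    exact Real.exp_le_one_iff.2 (by nlinarith [abs_nonneg y])
  have h1 : Integrable fun y : ℝ ↦ φ y * (Real.exp (-t * |y|) : ℂ) :=
    φ.integrable.mul_bdd (c := 1) hexp.aestronglyMeasurable (Eventually.of_forall hb)
  have h2 : Integrable fun y : ℝ ↦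
      {y : ℝ | |y| ≤ 1}.indicator (fun _ ↦ φ 0) y * (Real.exp (-t * |y|) : ℂ) :=
    (integrable_indicator_abs_le_one (φ 0)).mul_bdd (c := 1) hexp.aestronglyMeasurable
      (Eventually.of_forall hb)
  simp only [finitePartNumerator, sub_mul]
  rw [integral_sub h1 h2, ← integral_exp_neg_mul_abs_le_one ht, ← integral_complex_ofReal,
    ← integral_const_mul, ← integral_indicator measurableSet_abs_le_one]
  simp [indicator_mul_left]

theorem integrable_fourierT_mul_logKernel (φ : 𝓢(ℝ, ℂ)) :
    Integrable (Function.uncurry fun x t : ℝ ↦ fourierT φ x * (logKernel x t : ℂ))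
      (volume.prod (volume.restrict (Ioi 0))) := by
  obtain ⟨ψ, hψ⟩ := exists_schwartz_eq_fourierT φ
  rw [hψ]
  have hm : Measurable (Function.uncurry fun x t : ℝ ↦ ψ x * (logKernel x t : ℂ)) := by
    have := ψ.continuous.measurable
    unfold Function.uncurry logKernel
    fun_prop
  have hne : ∀ᵐ y : ℝ, y ≠ 0 := Measure.ae_ne volume 0
  refine (integrable_prod_iff hm.aestronglyMeasurable).2 ⟨?_, ?_⟩
  · filter_upwards [hne] with x hx
    have h : IntegrableOn (fun t : ℝ ↦ (logKernel x t : ℂ)) (Ioi 0) :=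
      (integrableOn_logKernel hx).ofReal
    exact h.const_mul (ψ x)
  · refine ψ.integrable_log_abs_mul.norm.congr ?_
    filter_upwards [hne] with x hx
    simp only [Function.uncurry, norm_mul, Complex.norm_real, integral_const_mul,
      integral_norm_logKernel hx]
    ring

theorem integral_fourierT_mul_logKernel (φ : 𝓢(ℝ, ℂ)) {t : ℝ} (ht : 0 < t) :
    ∫ x : ℝ, fourierT φ x * (logKernel x t : ℂ)
      = 2 * π * φ 0 * ((t / (1 + t ^ 2) - (1 - Real.exp (-t)) / t : ℝ) : ℂ)
        - π * ∫ y : ℝ, finitePartNumerator φ y * (Real.exp (-t * |y|) : ℂ) := by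
  obtain ⟨ψ, hψ⟩ := exists_schwartz_eq_fourierT φ
  have h0 : ∫ x : ℝ, fourierT φ x = 2 * π * φ 0 := by
    simpa using integral_fourierT_mul_exp φ 0
  have hi : Integrable (fourierT φ) := hψ ▸ ψ.integrable
  have hi2 : Integrable fun x : ℝ ↦ fourierT φ x * ((t / (x ^ 2 + t ^ 2) : ℝ) : ℂ) := by
    refine hi.mul_bdd (c := t / t ^ 2) (Measurable.aestronglyMeasurable (by fun_prop))
      (Eventually.of_forall fun x ↦ ?_)
    rw [Complex.norm_real, Real.norm_of_nonneg (by positivity)]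
    gcongr
    nlinarith [sq_nonneg x]
  simp only [logKernel, Complex.ofReal_sub, mul_sub]
  rw [integral_sub (hi.mul_const _) hi2, integral_mul_const, h0,
    integral_fourierT_mul_cauchy φ ht, integral_mul_exp_neg_mul_abs φ ht]
  push_cast
  ring

/-- Distributional Fourier transform of `log|x|`:
`∫ log|x| φ̂(x) dx = −π·Pf(1/|x|)[φ] − 2πγ φ(0)`, where
`Pf(1/|x|)[φ] = ∫_{|x|≤1}(φ(x)−φ(0))/|x| dx + ∫_{|x|>1} φ(x)/|x| dx`
and `γ` is the Euler–Mascheroni constant. -/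
theorem fourier_log_abs (φ : SchwartzMap ℝ ℂ) :
    ∫ x : ℝ, ((Real.log |x| : ℝ) : ℂ) * fourierT φ x =
      -(π : ℂ) * ((∫ x in {x : ℝ | |x| ≤ 1}, (φ x - φ 0) / ((|x| : ℝ) : ℂ)) +
          ∫ x in {x : ℝ | 1 < |x|}, φ x / ((|x| : ℝ) : ℂ)) -
        2 * (π : ℂ) * (Real.eulerMascheroniConstant : ℂ) * φ 0 := by
  have hI : IntegrableOn (fun t : ℝ ↦ ∫ y : ℝ,
      finitePartNumerator φ y * (Real.exp (-t * |y|) : ℂ)) (Ioi 0) :=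
    (integrable_finitePartNumerator_mul_exp φ).integral_prod_right
  have hJ : IntegrableOn (fun t : ℝ ↦
      ((t / (1 + t ^ 2) - (1 - Real.exp (-t)) / t : ℝ) : ℂ)) (Ioi 0) :=
    integrableOn_div_one_add_sq_sub_one_sub_exp_neg_div.ofReal
  calc ∫ x : ℝ, ((Real.log |x| : ℝ) : ℂ) * fourierT φ x
      = ∫ x : ℝ, ∫ t in Ioi (0 : ℝ), fourierT φ x * (logKernel x t : ℂ) := by
        refine integral_congr_ae ?_
        filter_upwards [Measure.ae_ne volume 0] with x hx
        rw [integral_const_mul, integral_complex_ofReal, integral_logKernel hx, mul_comm]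
    _ = ∫ t in Ioi (0 : ℝ), ∫ x : ℝ, fourierT φ x * (logKernel x t : ℂ) :=
        integral_integral_swap (integrable_fourierT_mul_logKernel φ)
    _ = ∫ t in Ioi (0 : ℝ),
          (2 * π * φ 0 * ((t / (1 + t ^ 2) - (1 - Real.exp (-t)) / t : ℝ) : ℂ)
            - π * ∫ y : ℝ, finitePartNumerator φ y * (Real.exp (-t * |y|) : ℂ)) :=
        setIntegral_congr_fun measurableSet_Ioi fun t ht ↦ integral_fourierT_mul_logKernel φ ht
    _ = _ := by
        rw [integral_sub (hJ.const_mul _) (hI.const_mul _), integral_const_mul, integral_const_mul,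
          integral_complex_ofReal, integral_div_one_add_sq_sub_one_sub_exp_neg_div,
          integral_integral_finitePartNumerator_mul_exp, integral_finitePartNumerator_div]
        push_cast
        ring
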